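/- arXiv:2303.16364 — 3 statements merged into one kernel-verified Lean document; each statement's English description precedes it below -/
import Mathlib

section
/- (Conditional second Bartlett identity.) Fix x ∈ ℝ^p. Assume that for λ-a.e. η the map x ↦ g(x,η) is twice differentiable at x, that η ↦ ∇ₓ g(x,η) and η ↦ Hessₓ g(x,η) are λ-integrable, that F is twice differentiable at x with ∇F(x) = ∫_H ∇ₓ g(x,η) dλ(η) and Hess F(x) = ∫_H Hessₓ g(x,η) dλ(η), and that the integrands below are λ-integrable. Writing Hessₓ log h(x,η) = Hessₓ log g(x,η) − Hess(log F)(x), one has the equality of p×p matrices ∫_H (−Hessₓ log h(x,η)) h(x,η) dλ(η) = ∫_H (∇ₓ log h(x,η))(∇ₓ log h(x,η))ᵀ h(x,η) dλ(η). -/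
open MeasureTheory

/-- Conditional second Bartlett identity: the conditional expectation of minus the
Hessian of `log h` equals the conditional expectation of the outer product of the
conditional score `∇ₓ log h`. -/
theorem stmt_2
    {p : ℕ} (hp : 1 ≤ p)
    {H : Type*} [MeasurableSpace H] (lam : Measure H) [SigmaFinite lam]
    (g : EuclideanSpace ℝ (Fin p) → H → ℝ)
    (hgmeas : ∀ x, Measurable (g x))
    (hgpos : ∀ x η, 0 < g x η)
    (F : EuclideanSpace ℝ (Fin p) → ℝ)
    (hFdef : ∀ x, F x = ∫ η, g x η ∂lam)
    (hgint : ∀ x, Integrable (g x) lam)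
    (hFpos : ∀ x, 0 < F x)
    (h : EuclideanSpace ℝ (Fin p) → H → ℝ)
    (hhdef : ∀ x η, h x η = g x η / F x)
    (x : EuclideanSpace ℝ (Fin p))
    -- the gradient and the Hessian of `g` in the state variable
    (Gg : EuclideanSpace ℝ (Fin p) → H → EuclideanSpace ℝ (Fin p))
    (Hg : H → Matrix (Fin p) (Fin p) ℝ)
    (hGg : ∀ᵐ η ∂lam, ∀ x', HasGradientAt (fun x'' => g x'' η) (Gg x' η) x')
    (hHg : ∀ᵐ η ∂lam, HasFDerivAt (fun x' => Gg x' η)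
      (LinearMap.toContinuousLinearMap (Matrix.toEuclideanLin (Hg η))) x)
    (hGgint : Integrable (fun η => Gg x η) lam)
    (hHgint : ∀ i j, Integrable (fun η => Hg η i j) lam)
    -- the gradient and the Hessian of `F`, with differentiation under the integral sign
    (GF : EuclideanSpace ℝ (Fin p) → EuclideanSpace ℝ (Fin p))
    (HF : Matrix (Fin p) (Fin p) ℝ)
    (hGF : ∀ x', HasGradientAt F (GF x') x')
    (hHF : HasFDerivAt GF (LinearMap.toContinuousLinearMap (Matrix.toEuclideanLin HF)) x)
    (hDUI1 : GF x = ∫ η, Gg x η ∂lam)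
    (hDUI2 : ∀ i j, HF i j = ∫ η, Hg η i j ∂lam)
    -- the conditional score `∇ₓ log h` and the Hessians of `log g`, `log F`, `log h`
    (S : H → EuclideanSpace ℝ (Fin p))
    (hS : ∀ η, S η = (g x η)⁻¹ • Gg x η - (F x)⁻¹ • GF x)
    (Hlogg : H → Matrix (Fin p) (Fin p) ℝ)
    (hHlogg : ∀ η, Hlogg η = (g x η)⁻¹ • Hg η -
      ((g x η) ^ 2)⁻¹ • Matrix.vecMulVec (Gg x η) (Gg x η))
    (HlogF : Matrix (Fin p) (Fin p) ℝ)
    (hHlogF : HlogF = (F x)⁻¹ • HF - ((F x) ^ 2)⁻¹ • Matrix.vecMulVec (GF x) (GF x))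
    (Hlogh : H → Matrix (Fin p) (Fin p) ℝ)
    (hHlogh : ∀ η, Hlogh η = Hlogg η - HlogF)
    -- integrability of the integrands below
    (hint1 : ∀ i j, Integrable (fun η => (-(Hlogh η i j)) * h x η) lam)
    (hint2 : ∀ i j, Integrable (fun η => (S η i * S η j) * h x η) lam) :
    ∀ i j, (∫ η, (-(Hlogh η i j)) * h x η ∂lam) =
      ∫ η, (S η i * S η j) * h x η ∂lam := by
  intro i j
  have hF0 : F x ≠ 0 := (hFpos x).ne'
  have hGgint_coord (k : Fin p) : Integrable (fun η => Gg x η k) lam :=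
    (EuclideanSpace.proj (𝕜 := ℝ) k).integrable_comp hGgint
  have hGgF (k : Fin p) : ∫ η, Gg x η k ∂lam = GF x k := by
    rw [hDUI1]
    exact (EuclideanSpace.proj (𝕜 := ℝ) k).integral_comp_comm hGgint
  rw [← sub_eq_zero, ← integral_sub (hint1 i j) (hint2 i j)]
  have hdiff (η : H) :
      -(Hlogh η i j) * h x η - S η i * S η j * h x η =
        (-(F x)⁻¹ * Hg η i j +
          (HF i j / F x ^ 2 - 2 * (GF x i * GF x j) / F x ^ 3) * g x η) +
        (GF x j / F x ^ 2 * Gg x η i + GF x i / F x ^ 2 * Gg x η j) := by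
    have hg0 : g x η ≠ 0 := (hgpos x η).ne'
    simp only [hHlogh, hHlogg, hHlogF, hS, hhdef, Matrix.sub_apply, Matrix.smul_apply,
      Matrix.vecMulVec_apply, PiLp.sub_apply, PiLp.smul_apply, smul_eq_mul]
    field_simp
    ring
  simp_rw [hdiff]
  have hHg_int := (hHgint i j).const_mul (-(F x)⁻¹)
  have hg_int := (hgint x).const_mul (HF i j / F x ^ 2 - 2 * (GF x i * GF x j) / F x ^ 3)
  have hGi_int := (hGgint_coord i).const_mul (GF x j / F x ^ 2)
  have hGj_int := (hGgint_coord j).const_mul (GF x i / F x ^ 2)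
  rw [integral_add (by exact hHg_int.add hg_int) (by exact hGi_int.add hGj_int),
    integral_add hHg_int hg_int, integral_add hGi_int hGj_int]
  simp only [integral_const_mul]
  rw [← hDUI2, ← hFdef, hGgF, hGgF]
  field_simp
  ring
end

section
/- (Monotonicity of the EM smoothing update.) Fix x, x′ ∈ ℝ^p and assume η ↦ log g(x,η) and η ↦ log g(x′,η) are integrable with respect to the probability measure h(x,·)·λ. If the EM objective does not decrease, i.e. ∫_H log g(x′,η) h(x,η) dλ(η) ≥ ∫_H log g(x,η) h(x,η) dλ(η), then log F(x′) ≥ log F(x); and if the EM objective strictly increases, then log F(x′) > log F(x). -/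
open MeasureTheory

/-- The Gibbs inequality for two unnormalized positive densities `u` and `v`. -/
theorem integral_log_mul_sub_le_log_integral_sub {α : Type*} [MeasurableSpace α] {μ : Measure α}
    {u v : α → ℝ} (hu : ∀ a, 0 < u a) (hv : ∀ a, 0 < v a)
    (hui : Integrable u μ) (hvi : Integrable v μ)
    (hU : 0 < ∫ a, u a ∂μ) (hV : 0 < ∫ a, v a ∂μ)
    (huu : Integrable (fun a => Real.log (u a) * (u a / ∫ b, u b ∂μ)) μ)
    (hvu : Integrable (fun a => Real.log (v a) * (u a / ∫ b, u b ∂μ)) μ) :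
    (∫ a, Real.log (v a) * (u a / ∫ b, u b ∂μ) ∂μ) -
        ∫ a, Real.log (u a) * (u a / ∫ b, u b ∂μ) ∂μ ≤
      Real.log (∫ a, v a ∂μ) - Real.log (∫ a, u a ∂μ) := by
  set U := ∫ a, u a ∂μ with hUdef
  set V := ∫ a, v a ∂μ with hVdef
  have pointwise_le (a : α) :
      Real.log (v a) * (u a / U) - Real.log (u a) * (u a / U) ≤
        (Real.log V - Real.log U) * (u a / U) + (v a / V - u a / U) := by
    have hua : 0 < u a / U := div_pos (hu a) hU
    have hva : 0 < v a / V := div_pos (hv a) hV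
    have hlog := mul_le_mul_of_nonneg_right
      (Real.log_le_sub_one_of_pos (div_pos hva hua)) hua.le
    rw [sub_mul, div_mul_cancel₀ _ hua.ne', one_mul, Real.log_div hva.ne' hua.ne',
      Real.log_div (hv a).ne' hV.ne', Real.log_div (hu a).ne' hU.ne'] at hlog
    linarith
  have hui' := hui.div_const U
  have hvi' := hvi.div_const V
  have hle := integral_mono (hvu.sub huu)
    ((hui'.const_mul (Real.log V - Real.log U)).add (hvi'.sub hui')) pointwise_le
  rw [integral_sub' hvu huu, integral_add' (hui'.const_mul _) (hvi'.sub hui'),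
    integral_const_mul, integral_sub' hvi' hui', integral_div, integral_div, ← hUdef, ← hVdef,
    div_self hU.ne', div_self hV.ne'] at hle
  linarith

/-- Monotonicity of the EM smoothing update: if the EM objective does not decrease
(resp. strictly increases) then the incomplete-data log-likelihood does not decrease
(resp. strictly increases). -/
theorem stmt_13
    {p : ℕ} (hp : 1 ≤ p)
    {H : Type*} [MeasurableSpace H] (lam : Measure H) [SigmaFinite lam]
    (g : EuclideanSpace ℝ (Fin p) → H → ℝ)
    (hgmeas : ∀ x, Measurable (g x))
    (hgpos : ∀ x η, 0 < g x η)
    (F : EuclideanSpace ℝ (Fin p) → ℝ)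
    (hFdef : ∀ x, F x = ∫ η, g x η ∂lam)
    (hgint : ∀ x, Integrable (g x) lam)
    (hFpos : ∀ x, 0 < F x)
    (h : EuclideanSpace ℝ (Fin p) → H → ℝ)
    (hhdef : ∀ x η, h x η = g x η / F x)
    (x x' : EuclideanSpace ℝ (Fin p))
    (hint1 : Integrable (fun η => Real.log (g x η) * h x η) lam)
    (hint2 : Integrable (fun η => Real.log (g x' η) * h x η) lam) :
    ((∫ η, Real.log (g x' η) * h x η ∂lam) ≥ (∫ η, Real.log (g x η) * h x η ∂lam) →
        Real.log (F x') ≥ Real.log (F x)) ∧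
    ((∫ η, Real.log (g x' η) * h x η ∂lam) > (∫ η, Real.log (g x η) * h x η ∂lam) →
        Real.log (F x') > Real.log (F x)) := by
  have hh : h x = fun η => g x η / ∫ η', g x η' ∂lam := by
    funext η
    rw [hhdef, hFdef]
  rw [hh] at hint1 hint2 ⊢
  have key := integral_log_mul_sub_le_log_integral_sub (hgpos x) (hgpos x') (hgint x) (hgint x')
    (hFdef x ▸ hFpos x) (hFdef x' ▸ hFpos x') hint1 hint2
  rw [hFdef x, hFdef x']
  constructor <;> intro hobj <;> linarith
end

section
/- (The Rauch–Tung–Striebel smoother solves the score equation, identity (38).) Let P and Q be symmetric positive definite p×p real matrices, F a p×p real matrix, G a p×m real matrix, u ∈ ℝ^m, and a, b ∈ ℝ^p. Set P′ = F P Fᵀ + Q and C = P Fᵀ (P′)⁻¹. Then the vector x* = a + C (b − (F a + G u)) is the unique solution x ∈ ℝ^p of the score equation P⁻¹ a − (P⁻¹ + Fᵀ Q⁻¹ F) x + Fᵀ Q⁻¹ (b − G u) = 0. (Here a plays the role of the filtered estimate x̂_{k|k}, b the smoother x̂ˢ_{k+1|n}, and F a + G u the one-step prediction x̂_{k+1|k}.)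 -/
open Matrix

/-- The information matrix times the smoother gain is `Fᵀ Q⁻¹`. -/
theorem Matrix.inv_add_mul_gain {m n R : Type*} [Fintype m] [DecidableEq m] [Fintype n]
    [DecidableEq n] [CommRing R] {P : Matrix n n R} {Q : Matrix m m R} {F : Matrix m n R}
    (hP : IsUnit P.det) (hQ : IsUnit Q.det) (hS : IsUnit (F * P * Fᵀ + Q).det) :
    (P⁻¹ + Fᵀ * Q⁻¹ * F) * (P * Fᵀ * (F * P * Fᵀ + Q)⁻¹) = Fᵀ * Q⁻¹ := by
  have h : (P⁻¹ + Fᵀ * Q⁻¹ * F) * (P * Fᵀ) = Fᵀ * Q⁻¹ * (F * P * Fᵀ + Q) := by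
    rw [Matrix.add_mul, Matrix.mul_add, nonsing_inv_mul_cancel_left _ _ hP, nonsing_inv_mul_cancel_right _ _ hQ,
      add_comm]
    simp only [Matrix.mul_assoc]
  rw [← Matrix.mul_assoc, h, mul_nonsing_inv_cancel_right _ _ hS]

/-- The Rauch–Tung–Striebel smoother solves the score equation (identity (38)):
`x* = a + C (b − (F a + G u))` with `C = P Fᵀ (F P Fᵀ + Q)⁻¹` is the unique solution of
`P⁻¹ a − (P⁻¹ + Fᵀ Q⁻¹ F) x + Fᵀ Q⁻¹ (b − G u) = 0`. -/
theorem stmt_17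
    {p m : ℕ} (hp : 1 ≤ p)
    (P Q : Matrix (Fin p) (Fin p) ℝ) (hP : P.PosDef) (hQ : Q.PosDef)
    (F : Matrix (Fin p) (Fin p) ℝ) (G : Matrix (Fin p) (Fin m) ℝ)
    (u : Fin m → ℝ) (a b : Fin p → ℝ) :
    ∀ x : Fin p → ℝ,
      P⁻¹.mulVec a - (P⁻¹ + Fᵀ * Q⁻¹ * F).mulVec x +
          (Fᵀ * Q⁻¹).mulVec (b - G.mulVec u) = 0 ↔
        x = a + (P * Fᵀ * (F * P * Fᵀ + Q)⁻¹).mulVec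
          (b - (F.mulVec a + G.mulVec u)) := by
  intro x
  have hS : (F * P * Fᵀ + Q).PosDef := by
    simpa using PosDef.posSemidef_add (hP.posSemidef.mul_mul_conjTranspose_same F) hQ
  have hM : (P⁻¹ + Fᵀ * Q⁻¹ * F).PosDef := by
    simpa using hP.inv.add_posSemidef (hQ.inv.posSemidef.conjTranspose_mul_mul_same F)
  have hgain := inv_add_mul_gain hP.det_pos.ne'.isUnit hQ.det_pos.ne'.isUnit
    hS.det_pos.ne'.isUnit (F := F)
  rw [← (mulVec_injective_of_isUnit hM.isUnit).eq_iff (a := x), mulVec_add _ a, mulVec_mulVec, hgain,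
    add_mulVec _ _ a, ← mulVec_mulVec a, ← sub_sub, sub_right_comm, mulVec_sub _ _ (F *ᵥ a),
    add_assoc, add_sub_cancel, sub_add_eq_add_sub, sub_eq_zero, eq_comm]
end
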